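/- arXiv:2309.10494 — 3 statements merged into one kernel-verified Lean document; each statement's English description precedes it below -/
import Mathlib

section
/- Let Γ be a countable discrete group and let M ⊆ L(Γ) be a Γ-invariant von Neumann subalgebra of L(Γ) that is amenable, i.e. admits an (M, τ₀)-hypertrace. Then M ⊆ L(Rad(Γ)). -/
open scoped InnerProductSpace ComplexOrder ENNReal
open ContinuousLinearMap

noncomputable section

/-- A group `G` is amenable if there is a left-translation-invariant state (invariant mean)
on the algebra `ℓ^∞(G)` of bounded complex functions on `G`. -/
def HasInvariantMean (G : Type*) [Group G] : Prop :=
  ∃ m : lp (fun _ : G => ℂ) ∞ →ₗ[ℂ] ℂ,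
    m 1 = 1 ∧
    (∀ f : lp (fun _ : G => ℂ) ∞, 0 ≤ m (star f * f)) ∧
    ∀ (g : G) (f₁ f₂ : lp (fun _ : G => ℂ) ∞), (∀ x : G, f₂ x = f₁ (g * x)) → m f₂ = m f₁

variable {Γ : Type*} [Group Γ] [Countable Γ]
variable {H : Type*} [NormedAddCommGroup H] [InnerProductSpace ℂ H] [CompleteSpace H]

/-- A state on `B(H)`: a positive linear functional taking the value `1` at the unit. -/
def IsStateB (φ : (H →L[ℂ] H) →ₗ[ℂ] ℂ) : Prop :=
  φ 1 = 1 ∧ ∀ T : H →L[ℂ] H, 0 ≤ φ (adjoint T * T)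

/-- The group von Neumann algebra `L(Γ)`: the double commutant of the range of the left
regular representation `lam`. -/
def groupVN (lam : Γ → H →L[ℂ] H) : Set (H →L[ℂ] H) :=
  Set.centralizer (Set.centralizer (Set.range lam))

/-- For a subgroup `K ≤ Γ`, the von Neumann subalgebra `L(K)` of `L(Γ)` generated by
`{lam h : h ∈ K}`, realized as the double commutant. -/
def subgroupVN (lam : Γ → H →L[ℂ] H) (K : Subgroup Γ) : Set (H →L[ℂ] H) :=
  Set.centralizer (Set.centralizer (lam '' (K : Set Γ)))

/-- The canonical trace `τ₀(x) = ⟨x δ_e, δ_e⟩` on `L(Γ)`, where `δ_e = b 1`. -/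
def tau0 (b : HilbertBasis Γ ℂ H) : (H →L[ℂ] H) → ℂ :=
  fun x => ⟪(b 1 : H), x (b 1)⟫_ℂ

/-- An `(M, τ₀)`-hypertrace: a state `φ` on `B(ℓ²(Γ))` with `φ|_{L(Γ)} = τ₀` and
`φ(mT) = φ(Tm)` for all `m ∈ M`, `T ∈ B(ℓ²(Γ))`. -/
def IsHypertrace (b : HilbertBasis Γ ℂ H) (lam : Γ → H →L[ℂ] H)
    (M : Set (H →L[ℂ] H)) (φ : (H →L[ℂ] H) →ₗ[ℂ] ℂ) : Prop :=
  IsStateB φ ∧ (∀ x ∈ groupVN lam, φ x = tau0 b x) ∧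
    ∀ m ∈ M, ∀ T : H →L[ℂ] H, φ (m * T) = φ (T * m)

section Diagonal

variable {ι : Type*}

omit [CompleteSpace H] in
theorem HilbertBasis.clm_ext (b : HilbertBasis ι ℂ H) {S T : H →L[ℂ] H}
    (h : ∀ i, S (b i) = T (b i)) : S = T := by
  refine ContinuousLinearMap.ext_on (s := Set.range b) ?_ ?_
  · rw [Submodule.dense_iff_topologicalClosure_eq_top]
    exact b.dense_span
  · rintro _ ⟨i, rfl⟩
    exact h i

/-- The diagonal operators in a Hilbert basis, as a linear map on `ℓ^∞`. -/
def diagOp (b : HilbertBasis ι ℂ H) : lp (fun _ : ι => ℂ) ∞ →L[ℂ] (H →L[ℂ] H) :=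
  (b.repr.symm.toContinuousLinearEquiv.conjContinuousAlgEquiv :
      (lp (fun _ : ι => ℂ) 2 →L[ℂ] lp (fun _ : ι => ℂ) 2) →L[ℂ] (H →L[ℂ] H)) ∘L
    lp.holderL 2 (fun _ : ι => ContinuousLinearMap.mul ℂ ℂ) (K := 1) (fun _ => by simp)

omit [CompleteSpace H] in
theorem diagOp_apply_basis (b : HilbertBasis ι ℂ H) (f : lp (fun _ : ι => ℂ) ∞) (i : ι) :
    diagOp b f (b i) = f i • b i := by
  classical
  apply b.repr.injective
  ext j
  suffices f j = f i ∨ b.repr (b i) j = 0 by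
    simpa [diagOp, ContinuousLinearEquiv.conjContinuousAlgEquiv, lp.holderL, lp.holderₗ, lp.holder]
  by_cases h : j = i
  · exact .inl (h ▸ rfl)
  · rw [b.repr_self]
    exact .inr (lp.single_apply_ne _ _ _ h)

omit [CompleteSpace H] in
theorem diagOp_one (b : HilbertBasis ι ℂ H) : diagOp b 1 = 1 :=
  b.clm_ext fun i => by simp [diagOp_apply_basis]

omit [CompleteSpace H] in
theorem diagOp_mul (b : HilbertBasis ι ℂ H) (f g : lp (fun _ : ι => ℂ) ∞) :
    diagOp b (f * g) = diagOp b f * diagOp b g :=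
  b.clm_ext fun i => by
    rw [mul_apply_eq_comp, diagOp_apply_basis, diagOp_apply_basis, map_smul,
      diagOp_apply_basis, smul_smul, mul_comm, lp.infty_coeFn_mul, Pi.mul_apply, mul_comm]

theorem diagOp_star (b : HilbertBasis ι ℂ H) (f : lp (fun _ : ι => ℂ) ∞) :
    diagOp b (star f) = star (diagOp b f) := by
  classical
  refine b.clm_ext fun i => b.repr.injective (lp.ext (funext fun j => ?_))
  rw [b.repr_apply_apply, b.repr_apply_apply, star_eq_adjoint, adjoint_inner_right,
    diagOp_apply_basis, diagOp_apply_basis, inner_smul_left, inner_smul_right,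
    orthonormal_iff_ite.1 b.orthonormal]
  split_ifs with h
  · simp [h]
  · simp

/-- A pointwise nonnegative element of `ℓ^∞` is the square of a selfadjoint element. -/
theorem lp.exists_mul_self_eq (f : lp (fun _ : ι => ℂ) ∞) (hf : ∀ i, 0 ≤ f i) :
    ∃ w : lp (fun _ : ι => ℂ) ∞, star w = w ∧ w * w = f := by
  refine ⟨⟨fun i => (√(f i).re : ℂ), memℓp_infty ⟨√‖f‖, ?_⟩⟩, ?_, ?_⟩
  · rintro _ ⟨i, rfl⟩
    simp only [Complex.norm_real, Real.norm_eq_abs, abs_of_nonneg (Real.sqrt_nonneg _)]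
    exact Real.sqrt_le_sqrt ((Complex.re_le_norm _).trans (lp.norm_apply_le_norm (by simp) f i))
  · ext i
    simp
  · ext i
    have h := Complex.nonneg_iff.1 (hf i)
    simp only [lp.infty_coeFn_mul, Pi.mul_apply]
    rw [← Complex.ofReal_mul, Real.mul_self_sqrt h.1]
    exact Complex.ext (by simp) (by simpa using h.2)

end Diagonal

section State

variable (H) in
/-- The states on `B(H)`, as a subset of the weak-* dual. -/
def stateSet : Set (WeakDual ℂ (H →L[ℂ] H)) :=
  {φ | φ 1 = 1 ∧ ∀ T : H →L[ℂ] H, 0 ≤ φ (star T * T)}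

/-- A state on `B(H)`, as a positive linear map. -/
def IsStateB.toPositive {φ : (H →L[ℂ] H) →ₗ[ℂ] ℂ} (h : IsStateB φ) : (H →L[ℂ] H) →ₚ[ℂ] ℂ :=
  PositiveLinearMap.mk₀ φ fun T hT => by
    obtain ⟨S, rfl⟩ := CStarAlgebra.nonneg_iff_eq_star_mul_self.1 hT
    exact h.2 S

theorem IsStateB.exists_weakDual {φ : (H →L[ℂ] H) →ₗ[ℂ] ℂ} (h : IsStateB φ) :
    ∃ ψ : WeakDual ℂ (H →L[ℂ] H), ∀ T, ψ T = φ T :=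
  ⟨StrongDual.toWeakDual ⟨φ, map_continuous h.toPositive⟩, fun _ => rfl⟩

variable {φ : WeakDual ℂ (H →L[ℂ] H)} (hφ : φ ∈ stateSet H)
include hφ

theorem stateSet.exists_positive : ∃ f : (H →L[ℂ] H) →ₚ[ℂ] ℂ, ∀ T, f T = φ T :=
  ⟨IsStateB.toPositive (φ := (WeakDual.toStrongDual φ : (H →L[ℂ] H) →ₗ[ℂ] ℂ)) hφ, fun _ => rfl⟩

theorem stateSet.map_star (T : H →L[ℂ] H) : φ (star T) = star (φ T) := by
  obtain ⟨f, hf⟩ := stateSet.exists_positive hφ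
  rw [← hf, ← hf, StarHomClass.map_star]

theorem stateSet.norm_star_mul_sq_le (S T : H →L[ℂ] H) :
    ‖φ (star S * T)‖ ^ 2 ≤ ‖φ (star S * S)‖ * ‖φ (star T * T)‖ := by
  obtain ⟨f, hf⟩ := stateSet.exists_positive hφ
  have key := norm_inner_le_norm (𝕜 := ℂ) (f.toPreGNS S) (f.toPreGNS T)
  have h (X : H →L[ℂ] H) : ‖f.toPreGNS X‖ ^ 2 = ‖φ (star X * X)‖ := by
    have := congrArg norm (f.preGNS_norm_sq (f.toPreGNS X))
    rw [← Complex.ofReal_pow, Complex.norm_real, Real.norm_of_nonneg (by positivity)] at this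
    rw [this, ← hf]
    rfl
  rw [← h, ← h, ← mul_pow, ← hf]
  exact pow_le_pow_left₀ (norm_nonneg _) key 2

theorem stateSet.norm_apply_le (T : H →L[ℂ] H) : ‖φ T‖ ≤ ‖T‖ := by
  obtain ⟨f, hf⟩ := stateSet.exists_positive hφ
  have h1 := stateSet.norm_star_mul_sq_le hφ 1 T
  have h2 : φ (star T * T) ≤ (‖T‖ ^ 2 : ℝ) := by
    rw [← hf]
    have := OrderHomClass.mono f (CStarAlgebra.star_mul_le_algebraMap_norm_sq (a := T))
    refine this.trans_eq ?_
    rw [hf, Algebra.algebraMap_eq_smul_one, ← Complex.coe_smul, map_smul, hφ.1]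
    simp
  have h3 : ‖φ (star T * T)‖ ≤ ‖T‖ ^ 2 := by
    have := CStarAlgebra.norm_le_norm_of_nonneg_of_le (hφ.2 T) h2
    simpa using this
  simp only [star_one, one_mul, hφ.1, norm_one] at h1
  exact le_of_sq_le_sq (h1.trans h3) (norm_nonneg _)

theorem stateSet.diagOp_nonneg {ι : Type*} (b : HilbertBasis ι ℂ H)
    {f : lp (fun _ : ι => ℂ) ∞} (hf : ∀ i, 0 ≤ f i) : 0 ≤ φ (diagOp b f) := by
  obtain ⟨w, hw, rfl⟩ := lp.exists_mul_self_eq f hf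
  have := hφ.2 (diagOp b w)
  rwa [← diagOp_star, hw, ← diagOp_mul] at this

/-- If a state has zero variance at a selfadjoint element, that element lies in its
multiplicative domain. -/
theorem stateSet.map_mul_of_variance_eq_zero {F : H →L[ℂ] H} (hF : star F = F)
    (h : φ (F * F) = φ F * φ F) (T : H →L[ℂ] H) :
    φ (T * F) = φ T * φ F ∧ φ (F * T) = φ F * φ T := by
  have hc : star (φ F) = φ F := by rw [← stateSet.map_star hφ, hF]
  set c := φ F with hcdef
  set Y := F - c • (1 : H →L[ℂ] H) with hY
  have hYs : star Y = Y := by simp [hY, hF, hc, star_smul]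
  have hYY : φ (star Y * Y) = 0 := by
    have : star Y * Y = F * F - (2 * c) • F + (c * c) • (1 : H →L[ℂ] H) := by
      rw [hYs, hY]
      simp only [sub_mul, mul_sub, smul_mul_assoc, mul_smul_comm, one_mul, mul_one]
      module
    rw [this, map_add, map_sub, map_smul, map_smul, h, hφ.1, ← hcdef]
    simp only [smul_eq_mul]
    ring
  have h1 : φ (T * Y) = 0 := by
    have := stateSet.norm_star_mul_sq_le hφ (star T) Y
    rw [hYY, star_star, norm_zero, mul_zero] at this
    simpa using le_antisymm this (by positivity)
  have h2 : φ (Y * T) = 0 := by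
    have := stateSet.norm_star_mul_sq_le hφ Y T
    rw [hYY, hYs, norm_zero, zero_mul] at this
    simpa using le_antisymm this (by positivity)
  constructor
  · rw [hY, mul_sub, map_sub, mul_smul_comm, map_smul, mul_one, sub_eq_zero] at h1
    rw [h1, smul_eq_mul, mul_comm]
  · rw [hY, sub_mul, map_sub, smul_mul_assoc, map_smul, one_mul, sub_eq_zero] at h2
    rw [h2, smul_eq_mul]

/-- Multiplying a state by a nonnegative density on the diagonal. -/
theorem stateSet.exists_density {ι : Type*} (b : HilbertBasis ι ℂ H)
    {u : lp (fun _ : ι => ℂ) ∞} (hu : ∀ t, 0 ≤ u t) (h0 : φ (diagOp b u) ≠ 0) :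
    ∃ ψ ∈ stateSet H, ∀ f, φ (diagOp b (u * f)) = φ (diagOp b u) * ψ (diagOp b f) := by
  obtain ⟨w, hw, rfl⟩ := lp.exists_mul_self_eq u hu
  set c := φ (diagOp b (w * w)) with hc
  have hc0 : 0 ≤ c := stateSet.diagOp_nonneg hφ b hu
  let A : (H →L[ℂ] H) →L[ℂ] (H →L[ℂ] H) :=
    ContinuousLinearMap.mul ℂ _ (diagOp b w) ∘L
      (ContinuousLinearMap.mul ℂ _).flip (diagOp b w)
  have hA (T : H →L[ℂ] H) : A T = diagOp b w * (T * diagOp b w) := rfl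
  let ψ : WeakDual ℂ (H →L[ℂ] H) :=
    StrongDual.toWeakDual (c⁻¹ • (WeakDual.toStrongDual φ ∘L A))
  have hψ (T : H →L[ℂ] H) : ψ T = c⁻¹ * φ (diagOp b w * (T * diagOp b w)) := rfl
  have hws : star (diagOp b w) = diagOp b w := by rw [← diagOp_star, hw]
  refine ⟨ψ, ⟨?_, fun T => ?_⟩, fun f => ?_⟩
  · rw [hψ, one_mul, ← diagOp_mul, ← hc, inv_mul_cancel₀ h0]
  · rw [hψ]
    refine mul_nonneg (inv_nonneg.2 hc0) ?_
    have := hφ.2 (T * diagOp b w)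
    rwa [star_mul, hws, mul_assoc, ← mul_assoc (star T)] at this
  · rw [hψ, mul_inv_cancel_left₀ h0, ← diagOp_mul, ← diagOp_mul, mul_comm f w, mul_assoc]

omit hφ

variable (H) in
theorem isClosed_stateSet : IsClosed (stateSet H) := by
  have : stateSet H = {φ | φ 1 = 1} ∩ ⋂ T : H →L[ℂ] H, {φ | 0 ≤ φ (star T * T)} := by
    ext; simp [stateSet]
  rw [this]
  exact (isClosed_eq (WeakDual.eval_continuous _) continuous_const).inter
    (isClosed_iInter fun T => isClosed_Ici.preimage (WeakDual.eval_continuous _))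

variable (H) in
theorem isCompact_stateSet : IsCompact (stateSet H) := by
  refine (WeakDual.isCompact_closedBall 0 1).of_isClosed_subset (isClosed_stateSet H) ?_
  intro φ hφ
  simp only [Set.mem_preimage, mem_closedBall_zero_iff]
  exact ContinuousLinearMap.opNorm_le_bound _ zero_le_one fun T => by
    simpa using stateSet.norm_apply_le hφ T

end State

section LeftRegular

variable {G : Type*} [Group G] {b : HilbertBasis G ℂ H} {lam : G → H →L[ℂ] H}

/-- `lam` is the left regular representation with respect to the basis `b`. -/
structure IsLeftRegularRep (b : HilbertBasis G ℂ H) (lam : G → H →L[ℂ] H) : Prop where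
  apply_basis : ∀ g t : G, lam g (b t) = b (g * t)
  map_mul : ∀ g h : G, lam (g * h) = lam g * lam h
  star_eq : ∀ g : G, star (lam g) = lam g⁻¹

/-- Conjugation `T ↦ λ(g)⁻¹ T λ(g)`. -/
def conjBy (lam : G → H →L[ℂ] H) (g : G) (T : H →L[ℂ] H) : H →L[ℂ] H :=
  lam g⁻¹ * T * lam g

/-- The left translate `t ↦ f (g t)` of a bounded function. -/
def leftTranslate (g : G) (f : lp (fun _ : G => ℂ) ∞) : lp (fun _ : G => ℂ) ∞ :=
  ⟨fun t => f (g * t), memℓp_infty ⟨‖f‖, by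
    rintro _ ⟨t, rfl⟩
    exact lp.norm_apply_le_norm (by simp) f _⟩⟩

namespace IsLeftRegularRep

variable (h : IsLeftRegularRep b lam)
include h

theorem map_one : lam 1 = 1 := b.clm_ext fun t => by simp [h.apply_basis]

theorem inv_mul_cancel (g : G) : lam g⁻¹ * lam g = 1 := by
  rw [← h.map_mul, _root_.inv_mul_cancel, h.map_one]

theorem mul_inv_cancel (g : G) : lam g * lam g⁻¹ = 1 := by
  rw [← h.map_mul, _root_.mul_inv_cancel, h.map_one]

theorem norm_le_one (g : G) : ‖lam g‖ ≤ 1 := by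
  refine ContinuousLinearMap.opNorm_le_bound _ zero_le_one fun x => ?_
  rw [one_mul]
  exact (((norm_map_iff_adjoint_comp_self (lam g)).2
    (by rw [← star_eq_adjoint, h.star_eq]; exact h.inv_mul_cancel g)) x).le

theorem norm_conjBy_le (g : G) (T : H →L[ℂ] H) : ‖conjBy lam g T‖ ≤ ‖T‖ := calc
  ‖conjBy lam g T‖ ≤ ‖lam g⁻¹‖ * ‖T‖ * ‖lam g‖ :=
    (norm_mul_le _ _).trans (by gcongr; exact norm_mul_le _ _)
  _ ≤ 1 * ‖T‖ * 1 := by gcongr <;> exact h.norm_le_one _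
  _ = ‖T‖ := by simp

theorem conjBy_mul (g : G) (S T : H →L[ℂ] H) :
    conjBy lam g (S * T) = conjBy lam g S * conjBy lam g T := by
  have := h.mul_inv_cancel g
  calc conjBy lam g (S * T) = lam g⁻¹ * S * 1 * T * lam g := by simp [conjBy, mul_assoc]
    _ = _ := by rw [← this]; simp only [conjBy, mul_assoc]

theorem conjBy_one (g : G) : conjBy lam g 1 = 1 := by
  rw [conjBy, mul_one, h.inv_mul_cancel]

theorem conjBy_one_left (T : H →L[ℂ] H) : conjBy lam 1 T = T := by
  simp [conjBy, h.map_one]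

theorem conjBy_conjBy (g k : G) (T : H →L[ℂ] H) :
    conjBy lam k (conjBy lam g T) = conjBy lam (g * k) T := by
  simp only [conjBy, mul_inv_rev, h.map_mul, mul_assoc]

theorem star_conjBy (g : G) (T : H →L[ℂ] H) : star (conjBy lam g T) = conjBy lam g (star T) := by
  simp [conjBy, h.star_eq, mul_assoc]

theorem conjBy_diagOp (g : G) (f : lp (fun _ : G => ℂ) ∞) :
    conjBy lam g (diagOp b f) = diagOp b (leftTranslate g f) :=
  b.clm_ext fun t => by
    simp [conjBy, mul_apply_eq_comp, h.apply_basis, diagOp_apply_basis, leftTranslate]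

/-- The Poisson transform `T ↦ (t ↦ φ(λ(t)⁻¹ T λ(t)))` of a functional on `B(H)`. -/
def poisson (φ : WeakDual ℂ (H →L[ℂ] H)) : (H →L[ℂ] H) →L[ℂ] lp (fun _ : G => ℂ) ∞ :=
  have hb (T : H →L[ℂ] H) (t : G) :
      ‖φ (conjBy lam t T)‖ ≤ ‖WeakDual.toStrongDual φ‖ * ‖T‖ :=
    ((WeakDual.toStrongDual φ).le_opNorm _).trans (by gcongr; exact h.norm_conjBy_le t T)
  LinearMap.mkContinuous
    { toFun T := ⟨fun t => φ (conjBy lam t T), memℓp_infty ⟨_, by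
        rintro _ ⟨t, rfl⟩
        exact hb T t⟩⟩
      map_add' S T := by
        ext t
        simp only [conjBy, mul_add, add_mul, map_add]
        rfl
      map_smul' c T := by ext t; simp [conjBy] }
    ‖WeakDual.toStrongDual φ‖
    fun T => lp.norm_le_of_forall_le (by positivity) (hb T)

theorem poisson_apply (φ : WeakDual ℂ (H →L[ℂ] H)) (T : H →L[ℂ] H) (t : G) :
    h.poisson φ T t = φ (conjBy lam t T) := rfl

theorem poisson_conjBy (φ : WeakDual ℂ (H →L[ℂ] H)) (g : G) (T : H →L[ℂ] H) :
    h.poisson φ (conjBy lam g T) = leftTranslate g (h.poisson φ T) := by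
  ext t
  simp only [poisson_apply, h.conjBy_conjBy]
  rfl

/-- The convolution of two functionals on `B(H)`. -/
def convolution (ψ φ : WeakDual ℂ (H →L[ℂ] H)) : WeakDual ℂ (H →L[ℂ] H) :=
  StrongDual.toWeakDual (WeakDual.toStrongDual ψ ∘L diagOp b ∘L h.poisson φ)

theorem convolution_apply (ψ φ : WeakDual ℂ (H →L[ℂ] H)) (T : H →L[ℂ] H) :
    h.convolution ψ φ T = ψ (diagOp b (h.poisson φ T)) := rfl

theorem poisson_convolution (ψ φ : WeakDual ℂ (H →L[ℂ] H)) (T : H →L[ℂ] H) :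
    h.poisson (h.convolution ψ φ) T = h.poisson ψ (diagOp b (h.poisson φ T)) := by
  ext t
  simp only [poisson_apply, convolution_apply, h.poisson_conjBy, h.conjBy_diagOp]

theorem convolution_assoc (χ ψ φ : WeakDual ℂ (H →L[ℂ] H)) :
    h.convolution (h.convolution χ ψ) φ = h.convolution χ (h.convolution ψ φ) :=
  DFunLike.ext _ _ fun T => by simp only [convolution_apply, h.poisson_convolution]

theorem continuous_convolution_left (φ : WeakDual ℂ (H →L[ℂ] H)) :
    Continuous fun ψ => h.convolution ψ φ :=
  WeakDual.continuous_of_continuous_eval fun _ => WeakDual.eval_continuous _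

theorem conjBy_star_mul_self (g : G) (T : H →L[ℂ] H) :
    conjBy lam g (star T * T) = star (T * lam g) * (T * lam g) := by
  simp [conjBy, h.star_eq, mul_assoc]

theorem convolution_mem_stateSet {ψ φ : WeakDual ℂ (H →L[ℂ] H)} (hψ : ψ ∈ stateSet H)
    (hφ : φ ∈ stateSet H) : h.convolution ψ φ ∈ stateSet H := by
  refine ⟨?_, fun T => stateSet.diagOp_nonneg hψ b fun t => ?_⟩
  · have : h.poisson φ 1 = 1 := by
      ext t
      simp [poisson_apply, h.conjBy_one, hφ.1]
    rw [convolution_apply, this, diagOp_one, hψ.1]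
  · have := hφ.2 (T * lam t)
    rwa [← h.conjBy_star_mul_self] at this

end IsLeftRegularRep

end LeftRegular

section Hypertrace

variable {G : Type*} [Group G] {b : HilbertBasis G ℂ H} {lam : G → H →L[ℂ] H}

/-- The hypertraces of `M`, as a subset of the weak-* dual of `B(H)`. -/
def hypertraceSet (b : HilbertBasis G ℂ H) (lam : G → H →L[ℂ] H) (M : Set (H →L[ℂ] H)) :
    Set (WeakDual ℂ (H →L[ℂ] H)) :=
  {φ | φ ∈ stateSet H ∧ (∀ x ∈ groupVN lam, φ x = tau0 b x) ∧
    ∀ m ∈ M, ∀ T : H →L[ℂ] H, φ (m * T) = φ (T * m)}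

theorem isCompact_hypertraceSet (b : HilbertBasis G ℂ H) (lam : G → H →L[ℂ] H)
    (M : Set (H →L[ℂ] H)) : IsCompact (hypertraceSet b lam M) := by
  refine (isCompact_stateSet H).of_isClosed_subset ?_ fun φ hφ => hφ.1
  have : hypertraceSet b lam M = stateSet H ∩
      ((⋂ x ∈ groupVN lam, {φ | φ x = tau0 b x}) ∩
        ⋂ m ∈ M, ⋂ T : H →L[ℂ] H, {φ | φ (m * T) = φ (T * m)}) := by
    ext
    simp only [hypertraceSet, Set.mem_inter_iff, Set.mem_iInter, Set.mem_ofPred_eq]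
  rw [this]
  refine (isClosed_stateSet H).inter (.inter ?_ ?_)
  · exact isClosed_biInter fun x _ => isClosed_eq (WeakDual.eval_continuous _) continuous_const
  · exact isClosed_biInter fun m _ => isClosed_iInter fun T =>
      isClosed_eq (WeakDual.eval_continuous _) (WeakDual.eval_continuous _)

namespace IsLeftRegularRep

omit [CompleteSpace H] [Group G] in
theorem lam_mem_groupVN (lam : G → H →L[ℂ] H) (g : G) : lam g ∈ groupVN lam :=
  Set.subset_centralizer_centralizer ⟨g, rfl⟩

omit [CompleteSpace H] in
theorem conjBy_mem_groupVN {x : H →L[ℂ] H} (hx : x ∈ groupVN lam) (g : G) :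
    conjBy lam g x ∈ groupVN lam :=
  Set.mul_mem_centralizer (Set.mul_mem_centralizer (lam_mem_groupVN lam _) hx)
    (lam_mem_groupVN lam _)

variable (h : IsLeftRegularRep b lam)
include h

theorem exists_rightTranslation (t : G) : ∃ ρ : H →ₗᵢ[ℂ] H, (∀ s, ρ (b s) = b (s * t)) ∧
    ρ.toContinuousLinearMap ∈ Set.centralizer (Set.range lam) := by
  classical
  have ho : Orthonormal ℂ fun s => b (s * t) := b.orthonormal.comp _ (mul_left_injective t)
  have hρ (s : G) : (ho.orthogonalFamily.linearIsometry.comp b.repr.toLinearIsometry) (b s) =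
      b (s * t) := by
    simp [b.repr_self, OrthogonalFamily.linearIsometry_apply_single]
  refine ⟨ho.orthogonalFamily.linearIsometry.comp b.repr.toLinearIsometry, hρ, ?_⟩
  rintro _ ⟨g, rfl⟩
  refine b.clm_ext fun s => ?_
  rw [mul_apply_eq_comp, mul_apply_eq_comp, LinearIsometry.coe_toContinuousLinearMap, hρ,
    h.apply_basis, h.apply_basis, hρ, mul_assoc]

theorem inner_apply_mul_right {x : H →L[ℂ] H} (hx : x ∈ groupVN lam) (s r t : G) :
    ⟪b (s * t), x (b (r * t))⟫_ℂ = ⟪b s, x (b r)⟫_ℂ := by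
  obtain ⟨ρ, hρ, hc⟩ := h.exists_rightTranslation t
  have := congrArg (· (b r)) (hx _ hc)
  simp only [mul_apply_eq_comp, LinearIsometry.coe_toContinuousLinearMap, hρ] at this
  rw [← hρ s, ← this, ρ.inner_map_map]

theorem inner_lam_inv (g : G) (v w : H) : ⟪v, lam g⁻¹ w⟫_ℂ = ⟪lam g v, w⟫_ℂ := by
  rw [← h.star_eq, star_eq_adjoint, adjoint_inner_right]

theorem tau0_conjBy {x : H →L[ℂ] H} (hx : x ∈ groupVN lam) (g : G) :
    tau0 b (conjBy lam g x) = tau0 b x := by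
  have := h.inner_apply_mul_right hx 1 1 g
  rw [one_mul] at this
  rw [tau0, tau0, conjBy, mul_apply_eq_comp, mul_apply_eq_comp, h.inner_lam_inv, h.apply_basis,
    mul_one, this]

theorem tau0_lam_inv_mul (g : G) (x : H →L[ℂ] H) :
    tau0 b (lam g⁻¹ * x) = ⟪b g, x (b 1)⟫_ℂ := by
  rw [tau0, mul_apply_eq_comp, h.inner_lam_inv, h.apply_basis, mul_one]

theorem convolution_mem_hypertraceSet {M : Set (H →L[ℂ] H)}
    (hM : ∀ g, ∀ m ∈ M, conjBy lam g m ∈ M) {ψ φ : WeakDual ℂ (H →L[ℂ] H)}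
    (hψ : ψ ∈ stateSet H) (hφ : φ ∈ hypertraceSet b lam M) :
    h.convolution ψ φ ∈ hypertraceSet b lam M := by
  refine ⟨h.convolution_mem_stateSet hψ hφ.1, fun x hx => ?_, fun m hm T => ?_⟩
  · have : h.poisson φ x = tau0 b x • 1 := by
      ext t
      simp [poisson_apply, hφ.2.1 _ (conjBy_mem_groupVN hx t), h.tau0_conjBy hx]
    rw [convolution_apply, this, map_smul, diagOp_one, map_smul, hψ.1, smul_eq_mul, mul_one]
  · have : h.poisson φ (m * T) = h.poisson φ (T * m) := by
      ext t
      rw [poisson_apply, poisson_apply, h.conjBy_mul, h.conjBy_mul, hφ.2.2 _ (hM t m hm)]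
    rw [convolution_apply, convolution_apply, this]

theorem hasSum_apply_basis {x : H →L[ℂ] H} (hx : x ∈ groupVN lam) (s : G) :
    HasSum (fun g => ⟪b g, x (b 1)⟫_ℂ • b (g * s)) (x (b s)) := by
  have := (b.hasSum_repr (x (b s)))
  rw [← (Equiv.mulRight s).hasSum_iff] at this
  convert this using 2 with g
  simp only [Function.comp, Equiv.coe_mulRight, b.repr_apply_apply]
  have := h.inner_apply_mul_right hx g 1 s
  rw [one_mul] at this
  rw [this]

/-- An element of `L(G)` whose Fourier coefficients are supported on `K` lies in `L(K)`. -/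
theorem mem_subgroupVN {x : H →L[ℂ] H} (hx : x ∈ groupVN lam) {K : Subgroup G}
    (hK : ∀ g, ⟪b g, x (b 1)⟫_ℂ ≠ 0 → g ∈ K) : x ∈ subgroupVN lam K := by
  intro y hy
  have hyl (g : G) (hg : g ∈ K) (v : H) : lam g (y v) = y (lam g v) :=
    congrArg (· v) (hy (lam g) ⟨g, hg, rfl⟩)
  refine b.clm_ext fun s => b.repr.injective (lp.ext (funext fun t => ?_))
  rw [b.repr_apply_apply, b.repr_apply_apply, mul_apply_eq_comp, mul_apply_eq_comp]
  have h1 : HasSum (fun g => ⟪b g, x (b 1)⟫_ℂ * ⟪b (g⁻¹ * t), y (b s)⟫_ℂ)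
      ⟪b t, y (x (b s))⟫_ℂ := by
    refine (congrArg (HasSum · _) (funext fun g => ?_)).mp
      (((h.hasSum_apply_basis hx s).mapL y).mapL (innerSL ℂ (b t)))
    simp only [innerSL_apply_apply]
    by_cases hg : ⟪b g, x (b 1)⟫_ℂ = 0
    · simp [hg]
    · have := h.inner_lam_inv g⁻¹ (b t) (y (b s))
      rw [inv_inv, h.apply_basis] at this
      rw [map_smul, inner_smul_right, ← h.apply_basis, ← hyl g (hK g hg), this]
  have h2 : HasSum (fun g => ⟪b g, x (b 1)⟫_ℂ * ⟪b (g⁻¹ * t), y (b s)⟫_ℂ)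
      ⟪b t, x (y (b s))⟫_ℂ := by
    have := ((b.hasSum_repr (y (b s))).mapL x).mapL (innerSL ℂ (b t))
    rw [← ((Equiv.inv G).trans (Equiv.mulRight t)).hasSum_iff] at this
    refine (congrArg (HasSum · _) (funext fun g => ?_)).mp this
    have := h.inner_apply_mul_right hx g 1 (g⁻¹ * t)
    rw [one_mul, mul_inv_cancel_left] at this
    simp [b.repr_apply_apply, this, mul_comm]
  exact h1.unique h2

end IsLeftRegularRep

end Hypertrace

section MinimalIdeal

/-- A compact set stable under the operations `op s`, `s ∈ S`, contains a minimal such set. -/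
theorem exists_minimal_stable {E : Type*} [TopologicalSpace E] [T2Space E] {X : Set E}
    (hX : IsCompact X) (hne : X.Nonempty) (S : Set E) (op : E → E → E)
    (hop : ∀ s ∈ S, ∀ x ∈ X, op s x ∈ X) :
    ∃ K ⊆ X, IsCompact K ∧ K.Nonempty ∧ (∀ s ∈ S, ∀ x ∈ K, op s x ∈ K) ∧
      ∀ L ⊆ K, IsCompact L → L.Nonempty → (∀ s ∈ S, ∀ x ∈ L, op s x ∈ L) → L = K := by
  obtain ⟨K, hKX, hK⟩ := zorn_superset_nonempty
    {K : Set E | IsCompact K ∧ K.Nonempty ∧ ∀ s ∈ S, ∀ x ∈ K, op s x ∈ K} (fun c hc hchain hcne => by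
      have : Nonempty c := hcne.to_subtype
      refine ⟨⋂₀ c, ⟨?_, ?_, ?_⟩, fun s hs => Set.sInter_subset_of_mem hs⟩
      · exact hcne.elim fun s hs => (hc hs).1.of_isClosed_subset
          (isClosed_sInter fun t ht => (hc ht).1.isClosed) (Set.sInter_subset_of_mem hs)
      · exact IsCompact.nonempty_sInter_of_directed_nonempty_isCompact_isClosed
          (IsChain.directedOn hchain.symm) (fun s hs => (hc hs).2.1) (fun s hs => (hc hs).1)
          (fun s hs => (hc hs).1.isClosed)
      · exact fun s hs x hx t ht => (hc ht).2.2 s hs x (hx t ht)) X ⟨hX, hne, hop⟩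
  exact ⟨K, hKX, hK.prop.1, hK.prop.2.1, hK.prop.2.2, fun L hL h1 h2 h3 =>
    hK.eq_of_subset ⟨h1, h2, h3⟩ hL⟩

end MinimalIdeal

section Extreme

variable {G : Type*} [Group G] {b : HilbertBasis G ℂ H} {lam : G → H →L[ℂ] H}

namespace IsLeftRegularRep

variable (h : IsLeftRegularRep b lam)
include h

/-- If `k = φ * k` is extreme in a set containing all `ψ * k`, then `φ` is multiplicative on
the Poisson transforms of `k` against any density bounded away from `0` and `1`. -/
theorem map_density_mul_poisson {K : Set (WeakDual ℂ (H →L[ℂ] H))} {k φ : WeakDual ℂ (H →L[ℂ] H)}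
    (hk : k ∈ K.extremePoints ℝ) (hK : ∀ ψ ∈ stateSet H, h.convolution ψ k ∈ K)
    (hφ : φ ∈ stateSet H) (hφk : h.convolution φ k = k)
    {u v : lp (fun _ : G => ℂ) ∞} (hu : ∀ t, 0 ≤ u t) (hv : ∀ t, 0 ≤ v t) (huv : u + v = 1)
    (hu0 : φ (diagOp b u) ≠ 0) (hv0 : φ (diagOp b v) ≠ 0) (T : H →L[ℂ] H) :
    φ (diagOp b (u * h.poisson k T)) = φ (diagOp b u) * k T := by
  obtain ⟨ψ, hψ, hψu⟩ := stateSet.exists_density hφ b hu hu0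
  obtain ⟨χ, hχ, hχv⟩ := stateSet.exists_density hφ b hv hv0
  have hcu := stateSet.diagOp_nonneg hφ b hu
  have hcv := stateSet.diagOp_nonneg hφ b hv
  have hsum : φ (diagOp b u) + φ (diagOp b v) = 1 := by
    rw [← map_add, ← map_add, huv, diagOp_one, hφ.1]
  have hk' (S : H →L[ℂ] H) : φ (diagOp b u) * h.convolution ψ k S +
      φ (diagOp b v) * h.convolution χ k S = k S := by
    conv_rhs => rw [← hφk]
    rw [convolution_apply, convolution_apply, convolution_apply, ← hψu, ← hχv, ← map_add,
      ← map_add, ← add_mul, huv, one_mul]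
  obtain ⟨hu1, hu2⟩ := Complex.nonneg_iff.1 hcu
  obtain ⟨hv1, hv2⟩ := Complex.nonneg_iff.1 hcv
  have hue : φ (diagOp b u) = ((φ (diagOp b u)).re : ℂ) := Complex.ext rfl (by simp [← hu2])
  have hve : φ (diagOp b v) = ((φ (diagOp b v)).re : ℂ) := Complex.ext rfl (by simp [← hv2])
  have hseg : k ∈ openSegment ℝ (h.convolution ψ k) (h.convolution χ k) := by
    refine ⟨(φ (diagOp b u)).re, (φ (diagOp b v)).re, hu1.lt_of_ne fun h0 => hu0 ?_,
      hv1.lt_of_ne fun h0 => hv0 ?_, ?_, DFunLike.ext _ _ fun S => ?_⟩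
    · rw [hue, ← h0, Complex.ofReal_zero]
    · rw [hve, ← h0, Complex.ofReal_zero]
    · simpa using congrArg Complex.re hsum
    · rw [← hk' S, hue, hve]
      rfl
  have hkψ := hk.2 (hK ψ hψ) (hK χ hχ) hseg
  rw [hψu]
  conv_rhs => rw [← hkψ]
  rfl

theorem star_poisson {k : WeakDual ℂ (H →L[ℂ] H)} (hk : k ∈ stateSet H) (T : H →L[ℂ] H) :
    star (h.poisson k T) = h.poisson k (star T) := by
  ext t
  rw [lp.star_apply, poisson_apply, poisson_apply, ← h.star_conjBy, stateSet.map_star hk]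

theorem norm_poisson_apply_le {k : WeakDual ℂ (H →L[ℂ] H)} (hk : k ∈ stateSet H)
    (T : H →L[ℂ] H) (t : G) : ‖h.poisson k T t‖ ≤ ‖T‖ :=
  (stateSet.norm_apply_le hk _).trans (h.norm_conjBy_le t T)

theorem variance_poisson_eq_zero {K : Set (WeakDual ℂ (H →L[ℂ] H))}
    {k φ : WeakDual ℂ (H →L[ℂ] H)}
    (hk : k ∈ K.extremePoints ℝ) (hK : ∀ ψ ∈ stateSet H, h.convolution ψ k ∈ K)
    (hks : k ∈ stateSet H) (hφ : φ ∈ stateSet H) (hφk : h.convolution φ k = k)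
    {a : H →L[ℂ] H} (ha : star a = a) (ha1 : ‖a‖ < 1) :
    φ (diagOp b (h.poisson k a) * diagOp b (h.poisson k a)) =
      φ (diagOp b (h.poisson k a)) * φ (diagOp b (h.poisson k a)) := by
  set f := h.poisson k a with hf
  have hφf : φ (diagOp b f) = k a := by conv_rhs => rw [← hφk, convolution_apply]
  have hreal (t : G) : f t = ((f t).re : ℂ) := by
    have : star (f t) = f t := by rw [← lp.star_apply, hf, h.star_poisson hks, ha]
    exact (Complex.conj_eq_iff_re.1 this).symm
  have hbound (t : G) : |(f t).re| ≤ 1 :=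
    (Complex.abs_re_le_norm _).trans ((h.norm_poisson_apply_le hks a t).trans ha1.le)
  have hka : ‖k a‖ < 1 := (stateSet.norm_apply_le hks a).trans_lt ha1
  set u : lp (fun _ : G => ℂ) ∞ := (2⁻¹ : ℂ) • (1 + f) with hu
  set v : lp (fun _ : G => ℂ) ∞ := (2⁻¹ : ℂ) • (1 - f) with hv
  have hut (t : G) : u t = ((2⁻¹ * (1 + (f t).re) : ℝ) : ℂ) := by
    push_cast
    rw [← hreal]
    rfl
  have hvt (t : G) : v t = ((2⁻¹ * (1 - (f t).re) : ℝ) : ℂ) := by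
    push_cast
    rw [← hreal]
    rfl
  have hφu : φ (diagOp b u) = 2⁻¹ * (1 + k a) := by
    rw [hu, map_smul, map_smul, map_add, map_add, diagOp_one, hφ.1, hφf, smul_eq_mul]
  have hφv : φ (diagOp b v) = 2⁻¹ * (1 - k a) := by
    rw [hv, map_smul, map_smul, map_sub, map_sub, diagOp_one, hφ.1, hφf, smul_eq_mul]
  have key := h.map_density_mul_poisson hk hK hφ hφk (u := u) (v := v)
    (fun t => by
      rw [hut, Complex.zero_le_real]
      linarith [neg_abs_le (f t).re, hbound t])
    (fun t => by
      rw [hvt, Complex.zero_le_real]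
      linarith [le_abs_self (f t).re, hbound t])
    (by rw [hu, hv]; module)
    (by
      rw [hφu]
      refine mul_ne_zero (by norm_num) fun h0 => ?_
      rw [eq_neg_of_add_eq_zero_right h0] at hka
      simp at hka)
    (by
      rw [hφv]
      refine mul_ne_zero (by norm_num) fun h0 => ?_
      rw [← sub_eq_zero.1 h0] at hka
      simp at hka) a
  rw [← hf, hφu, hu, smul_mul_assoc, add_mul, one_mul, map_smul, map_smul, map_add, map_add, hφf,
    smul_eq_mul] at key
  rw [← diagOp_mul, hφf]
  linear_combination 2 * key

/-- A nonzero Fourier coefficient at `g` of an element of `M` forces the extreme hypertrace `k`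
to be invariant under conjugation by `g`. -/
theorem conjBy_invariant_of_coeff_ne_zero {M : Set (H →L[ℂ] H)} (hM : M ⊆ groupVN lam)
    {K : Set (WeakDual ℂ (H →L[ℂ] H))} {k φ : WeakDual ℂ (H →L[ℂ] H)}
    (hk : k ∈ K.extremePoints ℝ) (hK : ∀ ψ ∈ stateSet H, h.convolution ψ k ∈ K)
    (hks : k ∈ stateSet H) (hφ : φ ∈ hypertraceSet b lam M) (hφk : h.convolution φ k = k)
    {m : H →L[ℂ] H} (hm : m ∈ M) {g : G} (hg : ⟪b g, m (b 1)⟫_ℂ ≠ 0) (a : H →L[ℂ] H) :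
    k (conjBy lam g a) = k a := by
  have hφk' (T : H →L[ℂ] H) : φ (diagOp b (h.poisson k T)) = k T := by
    conv_rhs => rw [← hφk, convolution_apply]
  have hcoeff : φ (lam g⁻¹ * m) = ⟪b g, m (b 1)⟫_ℂ := by
    rw [hφ.2.1 _ (Set.mul_mem_centralizer (lam_mem_groupVN lam _) (hM hm)), h.tau0_lam_inv_mul]
  have small (a : H →L[ℂ] H) (ha : star a = a) (ha1 : ‖a‖ < 1) : k (conjBy lam g a) = k a := by
    have dom (c : H →L[ℂ] H) (hc : star c = c) (hc1 : ‖c‖ < 1) :=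
      stateSet.map_mul_of_variance_eq_zero hφ.1 (F := diagOp b (h.poisson k c))
        (by rw [← diagOp_star, h.star_poisson hks, hc])
        (h.variance_poisson_eq_zero hk hK hks hφ.1 hφk hc hc1)
    have h1 := (dom a ha ha1 (m * lam g⁻¹)).1
    have h2 := (dom (conjBy lam g a) (by rw [h.star_conjBy, ha])
      ((h.norm_conjBy_le g a).trans_lt ha1) (lam g⁻¹ * m)).2
    rw [h.poisson_conjBy, ← h.conjBy_diagOp] at h2
    have e : m * lam g⁻¹ * diagOp b (h.poisson k a) =
        m * (conjBy lam g (diagOp b (h.poisson k a)) * lam g⁻¹) := by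
      simp only [conjBy, mul_assoc, h.mul_inv_cancel, mul_one]
    rw [e, hφ.2.2 m hm, mul_assoc, h2, hφ.2.2 m hm, hcoeff, h.conjBy_diagOp, ← h.poisson_conjBy,
      hφk', hφk', mul_comm] at h1
    exact mul_left_cancel₀ hg h1
  have sa (a : H →L[ℂ] H) (ha : star a = a) : k (conjBy lam g a) = k a := by
    have hpos : 0 < ‖a‖ + 1 := by positivity
    obtain ⟨r, hr⟩ : ∃ r : ℂ, r = (((‖a‖ + 1)⁻¹ : ℝ) : ℂ) := ⟨_, rfl⟩
    have hr0 : r ≠ 0 := by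
      rw [hr, Complex.ofReal_ne_zero]
      exact inv_ne_zero hpos.ne'
    have := small (r • a) (by rw [star_smul, ha, hr]; simp) (by
      rw [norm_smul, hr, Complex.norm_real, Real.norm_of_nonneg (by positivity),
        inv_mul_lt_one₀ hpos]
      linarith)
    have e : conjBy lam g (r • a) = r • conjBy lam g a := by simp [conjBy]
    rw [e, map_smul, map_smul] at this
    exact mul_left_cancel₀ hr0 this
  have hre := sa (realPart a) (realPart a).2
  have him := sa (imaginaryPart a) (imaginaryPart a).2
  have e : conjBy lam g a =
      conjBy lam g (realPart a) + Complex.I • conjBy lam g (imaginaryPart a) := by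
    conv_lhs => rw [← realPart_add_I_smul_imaginaryPart a]
    simp [conjBy, mul_add, add_mul]
  rw [e, map_add, map_smul, hre, him, ← map_smul, ← map_add, realPart_add_I_smul_imaginaryPart]

/-- The group elements whose conjugation action fixes a given functional. -/
def conjStabilizer (k : WeakDual ℂ (H →L[ℂ] H)) : Subgroup G where
  carrier := {g | ∀ a, k (conjBy lam g a) = k a}
  mul_mem' {g g'} hg hg' a := by rw [← h.conjBy_conjBy, hg', hg]
  one_mem' a := by rw [h.conjBy_one_left]
  inv_mem' {g} hg a := by
    rw [← hg, h.conjBy_conjBy, _root_.inv_mul_cancel, h.conjBy_one_left]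

/-- A subgroup fixing a state of `B(ℓ²(G))` by conjugation is amenable. -/
theorem hasInvariantMean_of_le_conjStabilizer {k : WeakDual ℂ (H →L[ℂ] H)} (hk : k ∈ stateSet H)
    {N : Subgroup G} (hN : N ≤ h.conjStabilizer k) : HasInvariantMean N := by
  let r (x : G) : G := (Quotient.mk (QuotientGroup.rightRel N) x).out
  have hr (x : G) : x * (r x)⁻¹ ∈ N :=
    QuotientGroup.rightRel_apply.1 (Quotient.mk_out (s := QuotientGroup.rightRel N) x)
  have hrg (g : N) (x : G) : r (g * x) = r x := by
    refine congrArg Quotient.out (Quotient.sound ?_)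
    change QuotientGroup.rightRel N _ _
    rw [QuotientGroup.rightRel_apply, mul_inv_rev, mul_inv_cancel_left]
    exact N.inv_mem g.2
  let n (x : G) : N := ⟨x * (r x)⁻¹, hr x⟩
  have hn (g : N) (x : G) : n (g * x) = g * n x := Subtype.ext (by simp [n, hrg, mul_assoc])
  let extend : lp (fun _ : N => ℂ) ∞ →ₗ[ℂ] lp (fun _ : G => ℂ) ∞ :=
    { toFun f := ⟨fun x => f (n x), memℓp_infty ⟨‖f‖, by
        rintro _ ⟨x, rfl⟩
        exact lp.norm_apply_le_norm (by simp) f _⟩⟩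
      map_add' _ _ := rfl
      map_smul' _ _ := rfl }
  have hext (f : lp (fun _ : N => ℂ) ∞) (x : G) : extend f x = f (n x) := rfl
  refine ⟨(WeakDual.toStrongDual k : (H →L[ℂ] H) →ₗ[ℂ] ℂ) ∘ₗ
    (diagOp b : lp (fun _ : G => ℂ) ∞ →ₗ[ℂ] (H →L[ℂ] H)) ∘ₗ extend, ?_, fun f => ?_,
    fun g f₁ f₂ hf => ?_⟩
  · change k (diagOp b (extend 1)) = 1
    have : extend 1 = 1 := by ext x; simp [hext]
    rw [this, diagOp_one, hk.1]
  · refine stateSet.diagOp_nonneg hk b fun x => ?_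
    rw [hext]
    exact star_mul_self_nonneg (f (n x))
  · change k (diagOp b (extend f₂)) = k (diagOp b (extend f₁))
    have : extend f₂ = leftTranslate (g : G) (extend f₁) := by
      ext x
      exact (hf (n x)).trans (congrArg f₁ (hn g x).symm)
    rw [this, ← h.conjBy_diagOp]
    exact hN g.2 _

end IsLeftRegularRep

end Extreme

/-- Let `Γ` be a countable discrete group and `M ⊆ L(Γ)` a `Γ`-invariant
amenable von Neumann subalgebra (i.e. admitting an `(M, τ₀)`-hypertrace). Then
`M ⊆ L(Rad(Γ))`, where `Rad(Γ)` is the amenable radical: the maximal amenable normal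
subgroup of `Γ`. -/
theorem invariant_amenable_subalgebra_subset_radical
    {Γ : Type*} [Group Γ] [Countable Γ]
    {H : Type*} [NormedAddCommGroup H] [InnerProductSpace ℂ H] [CompleteSpace H]
    (b : HilbertBasis Γ ℂ H) (lam : Γ → H →L[ℂ] H)
    (hlam : ∀ g t : Γ, lam g (b t) = b (g * t))
    (hmul : ∀ g h : Γ, lam (g * h) = lam g * lam h)
    (hadj : ∀ g : Γ, adjoint (lam g) = lam g⁻¹)
    (M : VonNeumannAlgebra H)
    (hM : (M : Set (H →L[ℂ] H)) ⊆ groupVN lam)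
    (hInv : ∀ g : Γ, ∀ m ∈ M, lam g * m * adjoint (lam g) ∈ M)
    (hAmen : ∃ φ : (H →L[ℂ] H) →ₗ[ℂ] ℂ, IsHypertrace b lam (M : Set (H →L[ℂ] H)) φ)
    (R : Subgroup Γ) (hRnormal : R.Normal) (hRamen : HasInvariantMean R)
    (hRmax : ∀ N : Subgroup Γ, N.Normal → HasInvariantMean N → N ≤ R) :
    (M : Set (H →L[ℂ] H)) ⊆ subgroupVN lam R := by
  have h : IsLeftRegularRep b lam := ⟨hlam, hmul, fun g => hadj g⟩
  have hconj (g : Γ) (m : H →L[ℂ] H) (hm : m ∈ (M : Set (H →L[ℂ] H))) :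
      conjBy lam g m ∈ (M : Set (H →L[ℂ] H)) := by
    have := hInv g⁻¹ m hm
    rwa [hadj, inv_inv] at this
  obtain ⟨ψ, hψ⟩ : (hypertraceSet b lam M).Nonempty := by
    obtain ⟨φ, hφ, hτ, hcomm⟩ := hAmen
    obtain ⟨ψ, hψ⟩ := hφ.exists_weakDual
    refine ⟨ψ, ⟨?_, fun T => ?_⟩, fun x hx => ?_, fun m hm T => ?_⟩
    · rw [hψ, hφ.1]
    · rw [hψ]
      exact hφ.2 T
    · rw [hψ, hτ x hx]
    · rw [hψ, hψ, hcomm m hm]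
  obtain ⟨K, hKX, hKc, hKne, hKs, hKmin⟩ := exists_minimal_stable
    (isCompact_hypertraceSet b lam M) ⟨ψ, hψ⟩ (stateSet H) h.convolution
    fun s hs x hx => h.convolution_mem_hypertraceSet hconj hs hx
  have : LocallyConvexSpace ℝ (WeakDual ℂ (H →L[ℂ] H)) :=
    WeakBilin.locallyConvexSpace
  obtain ⟨k, hk⟩ := hKc.extremePoints_nonempty (E := WeakDual ℂ (H →L[ℂ] H)) hKne
  have hkK : k ∈ K := hk.1
  have himage : (fun φ => h.convolution φ k) '' K = K := by
    refine hKmin _ ?_ (hKc.image (h.continuous_convolution_left k)) (hKne.image _) ?_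
    · rintro _ ⟨φ, hφ, rfl⟩
      exact hKs φ (hKX hφ).1 k hkK
    · rintro s hs _ ⟨φ, hφ, rfl⟩
      exact ⟨h.convolution s φ, hKs s hs φ hφ, h.convolution_assoc s φ k⟩
  obtain ⟨φ, hφ, hφk⟩ : k ∈ (fun φ => h.convolution φ k) '' K := himage.symm ▸ hkK
  intro m hm
  refine h.mem_subgroupVN (hM hm) fun g hg => hRmax (h.conjStabilizer k).normalCore inferInstance
    (h.hasInvariantMean_of_le_conjStabilizer (hKX hkK).1 (Subgroup.normalCore_le _)) fun t a => ?_
  refine h.conjBy_invariant_of_coeff_ne_zero hM hk (fun s hs => hKs s hs k hkK) (hKX hkK).1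
    (hKX hφ) hφk (hconj t⁻¹ m hm) ?_ a
  have e := h.inner_apply_mul_right (hM hm) g 1 t⁻¹
  rw [one_mul] at e
  rwa [conjBy, inv_inv, mul_apply_eq_comp, mul_apply_eq_comp, h.apply_basis, mul_one,
    ← inv_inv t, h.inner_lam_inv, h.apply_basis, inv_inv, mul_assoc, inv_mul_cancel_left, e]

end
end

section
/- Let H be a separable complex Hilbert space, M ⊆ B(H) a von Neumann algebra, and ξ ∈ H a unit vector cyclic for M such that τ(m) := ⟨mξ, ξ⟩ defines a tracial state on M (i.e. τ(xy) = τ(yx) for all x, y ∈ M). Let N ⊆ M be a von Neumann subalgebra which equals the double commutant of ⋃ₙ Qₙ for some increasing sequence Q₁ ⊆ Q₂ ⊆ ⋯ of finite-dimensional unital *-subalgebras of N. Then there exists a state φ on B(H) such that φ|_M = τ and φ(xT) = φ(Tx) for all x ∈ N and all T ∈ B(H). -/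
open scoped InnerProductSpace ComplexOrder ENNReal
open ContinuousLinearMap

noncomputable section

variable {Γ : Type*} [Group Γ] [Countable Γ]
variable {H : Type*} [NormedAddCommGroup H] [InnerProductSpace ℂ H] [CompleteSpace H]

/-- The approximation half of the double commutant theorem, at a single vector. -/
theorem apply_mem_closure_of_mem_centralizer_centralizer (A : StarSubalgebra ℂ (H →L[ℂ] H))
    (ξ : H) {x : H →L[ℂ] H}
    (hx : x ∈ Set.centralizer (Set.centralizer (A : Set (H →L[ℂ] H)))) :
    x ξ ∈ closure ((fun a : H →L[ℂ] H => a ξ) '' A) := by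
  let ev : (H →L[ℂ] H) →ₗ[ℂ] H := (ContinuousLinearMap.apply ℂ H ξ).toLinearMap
  let K : Submodule ℂ H := ((Subalgebra.toSubmodule A.toSubalgebra).map ev).topologicalClosure
  have hK : (K : Set H) = closure ((fun a : H →L[ℂ] H => a ξ) '' A) := rfl
  have : CompleteSpace K := (Submodule.isClosed_topologicalClosure _).completeSpace_coe
  have hinv : ∀ a ∈ A, K ∈ Module.End.invtSubmodule (a : H →ₗ[ℂ] H) := by
    intro a ha v hv
    change a v ∈ (K : Set H)
    have hv' : v ∈ (K : Set H) := hv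
    rw [hK] at hv' ⊢
    refine map_mem_closure a.continuous hv' ?_
    rintro _ ⟨b, hb, rfl⟩
    exact ⟨a * b, mul_mem ha hb, rfl⟩
  have hp : K.starProjection ∈ Set.centralizer (A : Set (H →L[ℂ] H)) := by
    have hcomm : ∀ a ∈ A, K.starProjection * a * K.starProjection = a * K.starProjection := by
      intro a ha
      ext v
      exact Submodule.starProjection_eq_self_iff.2
        (hinv a ha (Submodule.starProjection_apply_mem K v))
    intro a ha
    have h1 := congr(star $(hcomm (star a) (star_mem ha)))
    simp only [star_mul, star_star, (isStarProjection_starProjection (U := K)).isSelfAdjoint.star_eq]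
      at h1
    rw [← hcomm a ha, mul_assoc, h1]
  have hξ : ξ ∈ K := subset_closure ⟨1, one_mem A, rfl⟩
  have h := congr($(hx _ hp) ξ)
  rw [← hK]
  simp only [mul_apply_eq_comp, Submodule.starProjection_eq_self_iff.2 hξ] at h
  exact Submodule.starProjection_eq_self_iff.1 h

instance unitary.compactSpace_of_properSpace {A : Type*} [NormedRing A] [StarRing A]
    [CStarRing A] [ProperSpace A] : CompactSpace (unitary A) := by
  refine isCompact_iff_compactSpace (s := (unitary A : Set A)).1 (Metric.isCompact_of_isClosed_isBounded isClosed_unitary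
    (isBounded_iff_forall_norm_le.2 ⟨1, fun u hu => ?_⟩))
  nontriviality A
  exact (CStarRing.norm_of_mem_unitary hu).le

theorem exists_isProbabilityMeasure_isMulLeftInvariant (G : Type*) [Group G] [TopologicalSpace G]
    [IsTopologicalGroup G] [CompactSpace G] [MeasurableSpace G] [BorelSpace G] :
    ∃ μ : MeasureTheory.Measure G,
      MeasureTheory.IsProbabilityMeasure μ ∧ μ.IsMulLeftInvariant :=
  ⟨MeasureTheory.Measure.haarMeasure ⊤,
    ⟨MeasureTheory.Measure.haarMeasure_self (K₀ := (⊤ : TopologicalSpace.PositiveCompacts G))⟩,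
    inferInstance⟩

/-- Averaging the vector functional of a unit trace vector for `M` over the unitary group of a
finite-dimensional *-subalgebra `Q` of `M`. -/
theorem exists_central_state_of_finiteDimensional (M : VonNeumannAlgebra H) (ξ : H) (hξ : ‖ξ‖ = 1)
    (htracial : ∀ x ∈ M, ∀ y ∈ M, ⟪ξ, (x * y) ξ⟫_ℂ = ⟪ξ, (y * x) ξ⟫_ℂ)
    (Q : StarSubalgebra ℂ (H →L[ℂ] H)) [FiniteDimensional ℂ Q]
    (hQ : (Q : Set (H →L[ℂ] H)) ⊆ M) :
    ∃ φ : (H →L[ℂ] H) →ₗ[ℂ] ℂ, IsStateB φ ∧ (∀ T, ‖φ T‖ ≤ ‖T‖) ∧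
      (∀ x ∈ M, φ x = ⟪ξ, x ξ⟫_ℂ) ∧ (∀ x ∈ M, ∀ T, ‖φ (x * T)‖ ≤ ‖x ξ‖ * ‖T‖) ∧
      (∀ x ∈ M, ∀ T, ‖φ (T * x)‖ ≤ ‖x ξ‖ * ‖T‖) ∧
      ∀ a ∈ Q, ∀ T, φ (a * T) = φ (T * a) := by
  have : ProperSpace Q := FiniteDimensional.proper ℂ Q
  have hcl : IsClosed (Q : Set (H →L[ℂ] H)) :=
    (Subalgebra.toSubmodule Q.toSubalgebra).closed_of_finiteDimensional
  let _ : MeasurableSpace (unitary Q) := borel _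
  have : BorelSpace (unitary Q) := ⟨rfl⟩
  obtain ⟨μ, hμ, hμ'⟩ := exists_isProbabilityMeasure_isMulLeftInvariant (unitary Q)
  let c : unitary Q → H →L[ℂ] H := fun u => ((u : Q) : H →L[ℂ] H)
  have hc : Continuous c := continuous_subtype_val.comp continuous_subtype_val
  have hcM : ∀ u, c u ∈ M := fun u => hQ (u : Q).2
  have hc1 : ∀ u, star (c u) * c u = 1 := fun u =>
    congr(($(Unitary.coe_star_mul_self u) : H →L[ℂ] H))
  have hc2 : ∀ u, c u * star (c u) = 1 := fun u =>
    congr(($(Unitary.coe_mul_star_self u) : H →L[ℂ] H))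
  have hnorm : ∀ u v, ‖c u v‖ = ‖v‖ := fun u v =>
    (ContinuousLinearMap.norm_map_iff_adjoint_comp_self (c u)).2 (hc1 u) v
  let f : (H →L[ℂ] H) → unitary Q → ℂ := fun T u => ⟪c u ξ, T (c u ξ)⟫_ℂ
  have hf : ∀ T, Continuous (f T) := fun T => by fun_prop
  have hfi : ∀ T, MeasureTheory.Integrable (f T) μ := fun T =>
    (hf T).integrable_of_hasCompactSupport (HasCompactSupport.of_compactSpace _)
  let φ : (H →L[ℂ] H) →ₗ[ℂ] ℂ :=
    { toFun := fun T => ∫ u, f T u ∂μ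
      map_add' := fun S T => by
        rw [← MeasureTheory.integral_add (hfi S) (hfi T)]
        simp [f]
      map_smul' := fun r T => by
        simp [f, MeasureTheory.integral_const_mul] }
  have hφ : ∀ T, φ T = ∫ u, f T u ∂μ := fun _ => rfl
  have hbound : ∀ T C, (∀ u, ‖f T u‖ ≤ C) → ‖φ T‖ ≤ C := by
    intro T C h
    simpa [hφ] using MeasureTheory.norm_integral_le_of_norm_le_const (μ := μ)
      (Filter.Eventually.of_forall h)
  have hcξ : ∀ u, ‖c u ξ‖ = 1 := fun u => (hnorm u ξ).trans hξ
  have hfM : ∀ x ∈ M, ∀ u, f x u = ⟪ξ, x ξ⟫_ℂ := by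
    intro x hx u
    have h := htracial (star (c u)) (star_mem (hcM u)) (x * c u) (mul_mem hx (hcM u))
    rw [mul_assoc x, hc2, mul_one] at h
    rw [← h]
    simp [f, ContinuousLinearMap.star_eq_adjoint, ContinuousLinearMap.adjoint_inner_right]
  have hfnorm : ∀ x ∈ M, ∀ u, ‖x (c u ξ)‖ = ‖x ξ‖ := by
    intro x hx u
    have h := hfM (star x * x) (mul_mem (star_mem hx) hx) u
    simp only [f, ContinuousLinearMap.star_eq_adjoint, mul_apply_eq_comp,
      ContinuousLinearMap.adjoint_inner_right, inner_self_eq_norm_sq_to_K] at h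
    exact (sq_eq_sq₀ (norm_nonneg _) (norm_nonneg _)).1 (by exact_mod_cast h)
  have hstar : ∀ x ∈ M, ‖(star x) ξ‖ = ‖x ξ‖ := by
    intro x hx
    have h := htracial x hx (star x) (star_mem hx)
    simp only [ContinuousLinearMap.star_eq_adjoint, mul_apply_eq_comp,
      ContinuousLinearMap.adjoint_inner_right, inner_self_eq_norm_sq_to_K] at h
    rw [← ContinuousLinearMap.adjoint_inner_left, inner_self_eq_norm_sq_to_K] at h
    exact (sq_eq_sq₀ (norm_nonneg _) (norm_nonneg _)).1 (by exact_mod_cast h)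
  refine ⟨φ, ⟨?_, fun T => ?_⟩, fun T => hbound T _ fun u => ?_, fun x hx => ?_,
    fun x hx T => hbound _ _ fun u => ?_, fun x hx T => hbound _ _ fun u => ?_, ?_⟩
  · simp [hφ, f, hcξ, inner_self_eq_norm_sq_to_K]
  · rw [hφ]
    refine MeasureTheory.integral_nonneg fun u => ?_
    simp only [f, mul_apply_eq_comp, ContinuousLinearMap.adjoint_inner_right,
      inner_self_eq_norm_sq_to_K]
    positivity
  · calc ‖f T u‖ ≤ ‖c u ξ‖ * ‖T (c u ξ)‖ := norm_inner_le_norm _ _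
      _ ≤ 1 * (‖T‖ * 1) := by
        rw [hcξ, ← hcξ u]; gcongr; exact T.le_opNorm _
      _ = ‖T‖ := by ring
  · simp [hφ, hfM x hx]
  · calc ‖f (x * T) u‖ = ‖⟪(star x) (c u ξ), T (c u ξ)⟫_ℂ‖ := by
          simp [f, ContinuousLinearMap.star_eq_adjoint, ContinuousLinearMap.adjoint_inner_left]
      _ ≤ ‖(star x) (c u ξ)‖ * ‖T (c u ξ)‖ := norm_inner_le_norm _ _
      _ ≤ ‖x ξ‖ * ‖T‖ := by
        rw [hfnorm _ (star_mem hx), hstar x hx]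
        gcongr
        simpa [hcξ] using T.le_opNorm (c u ξ)
  · calc ‖f (T * x) u‖ ≤ ‖c u ξ‖ * ‖T (x (c u ξ))‖ := norm_inner_le_norm _ _
      _ ≤ ‖x ξ‖ * ‖T‖ := by
        rw [hcξ, one_mul, mul_comm, ← hfnorm x hx u]
        exact T.le_opNorm _
  · have hinv : ∀ v T, φ (c v * T) = φ (T * c v) := by
      intro v T
      rw [hφ, hφ, ← MeasureTheory.integral_mul_left_eq_self (f (c v * T)) v]
      refine MeasureTheory.integral_congr_ae (Filter.Eventually.of_forall fun u => ?_)
      have hmul : c (v * u) = c v * c u := rfl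
      simp only [f, hmul, mul_apply_eq_comp]
      rw [← ContinuousLinearMap.adjoint_inner_right, ← ContinuousLinearMap.star_eq_adjoint,
        ← mul_apply_eq_comp (star (c v)), hc1, one_apply_eq_self]
    have hspan := CStarAlgebra.span_unitary (A := Q)
    intro a ha T
    have ha' : (⟨a, ha⟩ : Q) ∈ Submodule.span ℂ (unitary Q : Set Q) := hspan ▸ trivial
    refine Submodule.span_induction (p := fun (b : Q) _ =>
      φ ((b : H →L[ℂ] H) * T) = φ (T * (b : H →L[ℂ] H))) (fun u hu => hinv ⟨u, hu⟩ T) ?_ ?_ ?_ ha'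
    · simp
    · intro b d _ _ hb hd
      simp [add_mul, mul_add, hb, hd]
    · intro r b _ hb
      simp [hb]

/-- Pointwise limit, along an ultrafilter, of contractive linear functionals. -/
theorem exists_linearMap_tendsto_of_norm_le {ι E : Type*} [NormedAddCommGroup E] [NormedSpace ℂ E]
    (l : Ultrafilter ι) (φ : ι → E →ₗ[ℂ] ℂ) (hφ : ∀ i x, ‖φ i x‖ ≤ ‖x‖) :
    ∃ ψ : E →ₗ[ℂ] ℂ, ∀ x, Filter.Tendsto (fun i => φ i x) l (nhds (ψ x)) := by
  have h : ∀ x, ∃ z : ℂ, Filter.Tendsto (fun i => φ i x) l (nhds z) := by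
    intro x
    obtain ⟨z, -, hz⟩ := (isCompact_closedBall (0 : ℂ) ‖x‖).ultrafilter_le_nhds
      (l.map fun i => φ i x) (by
        rw [Filter.le_principal_iff]
        exact Filter.Eventually.of_forall (f := (l : Filter ι)) fun i => by simpa using hφ i x)
    exact ⟨z, hz⟩
  choose ψ hψ using h
  exact ⟨linearMapOfTendsto ψ φ (tendsto_pi_nhds.2 hψ), hψ⟩

/-- Let `M ⊆ B(H)` be a von Neumann algebra on a separable Hilbert space with
a unit cyclic vector `ξ` such that `τ(m) = ⟨mξ, ξ⟩` is a tracial state on `M`. If `N ⊆ M` is a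
von Neumann subalgebra equal to the double commutant of an increasing union of
finite-dimensional unital *-subalgebras, then there is a state `φ` on `B(H)` with `φ|_M = τ`
which is `N`-central (an `N`-hypertrace). -/
theorem hypertrace_of_hyperfinite_subalgebra
    {H : Type*} [NormedAddCommGroup H] [InnerProductSpace ℂ H] [CompleteSpace H]
    [TopologicalSpace.SeparableSpace H]
    (M : VonNeumannAlgebra H) (ξ : H) (hξ : ‖ξ‖ = 1)
    (hcyclic : Dense {y : H | ∃ m ∈ M, m ξ = y})
    (htracial : ∀ x ∈ M, ∀ y ∈ M, ⟪ξ, (x * y) ξ⟫_ℂ = ⟪ξ, (y * x) ξ⟫_ℂ)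
    (N : VonNeumannAlgebra H) (hNM : (N : Set (H →L[ℂ] H)) ⊆ M)
    (Q : ℕ → StarSubalgebra ℂ (H →L[ℂ] H))
    (hQN : ∀ n, (Q n : Set (H →L[ℂ] H)) ⊆ N)
    (hQmono : Monotone Q)
    (hQfd : ∀ n, FiniteDimensional ℂ (Q n))
    (hQgen : (N : Set (H →L[ℂ] H)) =
      Set.centralizer (Set.centralizer (⋃ n, (Q n : Set (H →L[ℂ] H))))) :
    ∃ φ : (H →L[ℂ] H) →ₗ[ℂ] ℂ, IsStateB φ ∧ (∀ x ∈ M, φ x = ⟪ξ, x ξ⟫_ℂ) ∧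
      ∀ x ∈ N, ∀ T : H →L[ℂ] H, φ (x * T) = φ (T * x) := by
  choose φ hstate hle hM hl hr hQc using fun n =>
    have := hQfd n
    exists_central_state_of_finiteDimensional M ξ hξ htracial (Q n) ((hQN n).trans hNM)
  let l : Ultrafilter ℕ := Filter.hyperfilter ℕ
  obtain ⟨ψ, hψ⟩ := exists_linearMap_tendsto_of_norm_le l φ hle
  have hψl : ∀ x ∈ M, ∀ T, ‖ψ (x * T)‖ ≤ ‖x ξ‖ * ‖T‖ := fun x hx T =>
    le_of_tendsto (hψ _).norm (Filter.Eventually.of_forall fun n => hl n x hx T)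
  have hψr : ∀ x ∈ M, ∀ T, ‖ψ (T * x)‖ ≤ ‖x ξ‖ * ‖T‖ := fun x hx T =>
    le_of_tendsto (hψ _).norm (Filter.Eventually.of_forall fun n => hr n x hx T)
  have hψQ : ∀ k, ∀ a ∈ Q k, ∀ T, ψ (a * T) = ψ (T * a) := by
    intro k a ha T
    refine tendsto_nhds_unique_of_eventuallyEq (hψ _) (hψ _) ?_
    have h : ∀ᶠ n in Filter.atTop, φ n (a * T) = φ n (T * a) :=
      (Filter.eventually_ge_atTop k).mono fun n hn => hQc n a (hQmono hn ha) T
    exact Nat.hyperfilter_le_atTop h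
  refine ⟨ψ, ⟨?_, fun T => ?_⟩, fun x hx => ?_, fun x hx T => ?_⟩
  · exact tendsto_nhds_unique (hψ 1) (by simp [fun n => (hstate n).1])
  · exact ge_of_tendsto (hψ _) (Filter.Eventually.of_forall fun n => (hstate n).2 T)
  · exact tendsto_nhds_unique (hψ x) (by simp [fun n => hM n x hx])
  · have hcoe : ((⨆ n, Q n : StarSubalgebra ℂ (H →L[ℂ] H)) : Set (H →L[ℂ] H)) =
        ⋃ n, (Q n : Set (H →L[ℂ] H)) := StarSubalgebra.coe_iSup_of_directed hQmono.directed_le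
    have hxN : x ∈ (N : Set (H →L[ℂ] H)) := hx
    rw [hQgen, ← hcoe] at hxN
    have hcl := apply_mem_closure_of_mem_centralizer_centralizer _ ξ hxN
    rw [hcoe, Metric.mem_closure_iff] at hcl
    rw [← sub_eq_zero, ← norm_le_zero_iff]
    refine le_of_forall_pos_le_add fun ε hε => ?_
    obtain ⟨_, ⟨a, ha, rfl⟩, hdist⟩ := hcl (ε / (2 * (‖T‖ + 1))) (by positivity)
    obtain ⟨k, hk⟩ := Set.mem_iUnion.1 ha
    have hxa : x - a ∈ M := sub_mem (hNM hx) (hNM (hQN k hk))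
    have hsplit : ψ (x * T) - ψ (T * x) = ψ ((x - a) * T) - ψ (T * (x - a)) := by
      simp [sub_mul, mul_sub, hψQ k a hk T]
    have hd : ‖(x - a) ξ‖ * (2 * (‖T‖ + 1)) < ε := by
      rw [← lt_div_iff₀ (by positivity)]
      simpa [dist_eq_norm] using hdist
    calc ‖ψ (x * T) - ψ (T * x)‖ ≤ ‖(x - a) ξ‖ * ‖T‖ + ‖(x - a) ξ‖ * ‖T‖ := by
          rw [hsplit]
          exact (norm_sub_le _ _).trans (add_le_add (hψl _ hxa T) (hψr _ hxa T))
      _ ≤ 0 + ε := by nlinarith [norm_nonneg ((x - a) ξ)]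

end
end

section
/- Let H be a complex Hilbert space, M ⊆ B(H) a von Neumann algebra, τ a tracial state on M, and φ a state on B(H) with φ|_M = τ. Let Q ⊆ M be a finite-dimensional unital *-subalgebra. Then there exists a state φ' on B(H) such that φ'|_M = τ and φ'(uT) = φ'(Tu) for every unitary u ∈ Q and every T ∈ B(H). -/
open scoped InnerProductSpace ComplexOrder ENNReal
open ContinuousLinearMap

noncomputable section

variable {Γ : Type*} [Group Γ] [Countable Γ]
variable {H : Type*} [NormedAddCommGroup H] [InnerProductSpace ℂ H] [CompleteSpace H]

/-- The unitary group of a finite-dimensional star subalgebra of `B(H)` is compact. -/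
theorem compactSpace_unitary_of_finiteDimensional
    {H : Type*} [NormedAddCommGroup H] [InnerProductSpace ℂ H] [CompleteSpace H]
    (Q : StarSubalgebra ℂ (H →L[ℂ] H)) [FiniteDimensional ℂ Q] :
    CompactSpace (unitary Q) := by
  have : ProperSpace Q := FiniteDimensional.proper ℂ Q
  refine isCompact_iff_compactSpace.mp (Metric.isCompact_of_isClosed_isBounded ?_ ?_)
  · have h : ((unitary Q : Submonoid Q) : Set Q)
        = {a | star a * a = 1} ∩ {a | a * star a = 1} := by
      ext a
      simp [Unitary.mem_iff]
    rw [h]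
    exact (isClosed_eq (by fun_prop) continuous_const).inter
      (isClosed_eq (by fun_prop) continuous_const)
  · refine (Metric.isBounded_closedBall (x := (0 : Q)) (r := 1)).subset fun a ha => ?_
    rw [mem_closedBall_zero_iff]
    have h1 : ‖star a * a‖ = ‖a‖ * ‖a‖ := CStarRing.norm_star_mul_self (x := (a : H →L[ℂ] H))
    have h2 : ‖star a * a‖ ≤ 1 := by
      rw [(Unitary.mem_iff.mp ha).1]
      exact ContinuousLinearMap.norm_id_le
    nlinarith [norm_nonneg a]

/-- For a linear functional `φ` on `B(H)`, the map `v ↦ φ (v* T v)` is continuous on any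
finite-dimensional star subalgebra. -/
theorem continuous_conj_of_finiteDimensional
    {H : Type*} [NormedAddCommGroup H] [InnerProductSpace ℂ H] [CompleteSpace H]
    (Q : StarSubalgebra ℂ (H →L[ℂ] H)) [FiniteDimensional ℂ Q]
    (φ : (H →L[ℂ] H) →ₗ[ℂ] ℂ) (T : H →L[ℂ] H) :
    Continuous fun v : Q => φ (star (v : H →L[ℂ] H) * T * v) := by
  let ι : Q →ₗ[ℂ] (H →L[ℂ] H) := Q.subtype.toAlgHom.toLinearMap
  let B : Q →ₗ[ℂ] Q →ₗ[ℂ] ℂ :=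
    (((LinearMap.mul ℂ (H →L[ℂ] H)).comp ((LinearMap.mulRight ℂ T).comp ι)).compl₂ ι).compr₂ φ
  let C : Q →ₗ[ℂ] Q →L[ℂ] ℂ :=
    (LinearMap.toContinuousLinearMap : (Q →ₗ[ℂ] ℂ) ≃ₗ[ℂ] _).toLinearMap.comp B
  have hC : Continuous C := C.continuous_of_finiteDimensional
  exact (hC.comp continuous_star).clm_apply continuous_id

/-- Let `M ⊆ B(H)` be a von Neumann algebra, `τ` a tracial state on `M`, and
`φ` a state on `B(H)` with `φ|_M = τ`. For any finite-dimensional unital *-subalgebra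
`Q ⊆ M`, there is a state `φ'` on `B(H)` with `φ'|_M = τ` such that `φ'(uT) = φ'(Tu)` for every
unitary `u ∈ Q` and every `T ∈ B(H)`. -/
theorem averaged_state_over_finite_dimensional_unitaries
    {H : Type*} [NormedAddCommGroup H] [InnerProductSpace ℂ H] [CompleteSpace H]
    (M : VonNeumannAlgebra H)
    (φ : (H →L[ℂ] H) →ₗ[ℂ] ℂ) (hφ : IsStateB φ)
    (htracial : ∀ x ∈ M, ∀ y ∈ M, φ (x * y) = φ (y * x))
    (Q : StarSubalgebra ℂ (H →L[ℂ] H)) (hQM : (Q : Set (H →L[ℂ] H)) ⊆ M)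
    (hQfd : FiniteDimensional ℂ Q) :
    ∃ φ' : (H →L[ℂ] H) →ₗ[ℂ] ℂ, IsStateB φ' ∧ (∀ x ∈ M, φ' x = φ x) ∧
      ∀ u ∈ Q, u * adjoint u = 1 → adjoint u * u = 1 →
        ∀ T : H →L[ℂ] H, φ' (u * T) = φ' (T * u) := by
  have := compactSpace_unitary_of_finiteDimensional Q
  let : MeasurableSpace (unitary Q) := borel _
  have : BorelSpace (unitary Q) := ⟨rfl⟩
  let μ : MeasureTheory.Measure (unitary Q) := MeasureTheory.Measure.haarMeasure ⊤
  have : MeasureTheory.IsProbabilityMeasure μ :=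
    ⟨MeasureTheory.Measure.haarMeasure_self
      (K₀ := (⊤ : TopologicalSpace.PositiveCompacts (unitary Q)))⟩
  let c (v : unitary Q) : H →L[ℂ] H := ((v : Q) : H →L[ℂ] H)
  have hcstar (v : unitary Q) : star (c v) * c v = 1 :=
    congrArg Subtype.val (Unitary.mem_iff.mp v.2).1
  have hcstar' (v : unitary Q) : c v * star (c v) = 1 :=
    congrArg Subtype.val (Unitary.mem_iff.mp v.2).2
  have hint (T : H →L[ℂ] H) :
      MeasureTheory.Integrable (fun v => φ (star (c v) * T * c v)) μ :=
    ((continuous_conj_of_finiteDimensional Q φ T).comp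
      continuous_subtype_val).integrable_of_hasCompactSupport
      (HasCompactSupport.of_compactSpace _)
  let ψ : (H →L[ℂ] H) →ₗ[ℂ] ℂ :=
    { toFun := fun T => ∫ v, φ (star (c v) * T * c v) ∂μ
      map_add' := fun S T => by
        simp only [mul_add, add_mul, map_add]
        exact MeasureTheory.integral_add (hint S) (hint T)
      map_smul' := fun a T => by
        simp only [mul_smul_comm, smul_mul_assoc, map_smul, RingHom.id_apply]
        exact MeasureTheory.integral_smul a _ }
  have hψ (T : H →L[ℂ] H) : ψ T = ∫ v, φ (star (c v) * T * c v) ∂μ := rfl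
  have hψM : ∀ x ∈ M, ψ x = φ x := fun x hx => by
    have h (v : unitary Q) : φ (star (c v) * x * c v) = φ x := by
      have hv : c v ∈ M := hQM (v : Q).2
      rw [mul_assoc, htracial _ (star_mem hv) _ (mul_mem hx hv), mul_assoc, hcstar', mul_one]
    simp [hψ, h]
  refine ⟨ψ, ⟨(hψM 1 (one_mem M)).trans hφ.1, fun T => ?_⟩, hψM, fun u hu h1 h2 T => ?_⟩
  · rw [hψ]
    refine MeasureTheory.integral_nonneg fun v => ?_
    change 0 ≤ φ (star (c v) * (adjoint T * T) * c v)
    have := hφ.2 (T * c v)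
    rw [← star_eq_adjoint, star_mul] at this
    simpa only [star_eq_adjoint, mul_assoc] using this
  · let w : unitary Q := ⟨⟨u, hu⟩, Unitary.mem_iff.mpr ⟨Subtype.ext h2, Subtype.ext h1⟩⟩
    have hmul (v : unitary Q) : c (w * v) = u * c v := rfl
    rw [hψ, hψ, ← MeasureTheory.integral_mul_left_eq_self _ w]
    refine MeasureTheory.integral_congr_ae (.of_forall fun v => ?_)
    have h2' : star u * u = 1 := h2
    simp only [hmul, star_mul]
    congr 1
    calc star (c v) * star u * (u * T) * (u * c v)
        = star (c v) * (star u * u) * T * u * c v := by simp only [mul_assoc]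
      _ = star (c v) * (T * u) * c v := by rw [h2', mul_one]; simp only [mul_assoc]

end
end
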